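/- Let P ∈ ℝ^{N×N} be symmetric positive definite with N = nd + m₀ + nd, ρ ∈ (0,1), L > 0. For each k = 1,…,K let f^k : ℝ^d → ℝ be differentiable and L-smooth with ∇f^k(x^{k,⋆}) = 0, let x_j^k ∈ ℝ^d for j = 1,…,n, and let z^k ∈ ℝ^N and z^{k,⋆} := (x̲^{k,⋆}, 0, ∇^{k,⋆}) ∈ ℝ^N, where x̲^{k,⋆} := (x^{k,⋆},…,x^{k,⋆}) ∈ ℝ^{nd}, the middle block is the zero vector of ℝ^{m₀}, and ∇^{k,⋆} ∈ ℝ^{nd}, satisfy: (i) ‖z^{k+1} − z^{k,⋆}‖_P ≤ ρ·‖z^k − z^{k,⋆}‖_P for all k; (ii) ‖x̲^k − x̲^{k,⋆}‖ ≤ ‖z^{k+1} − z^{k,⋆}‖ with x̲^k := (x_1^k,…,x_n^k). Then Reg^K := (1/n)·Σ_{j=1}^n Σ_{k=1}^K (f^k(x_j^k) − f^k(x^{k,⋆})) ≤ (2Lρ²/(n·λ_min(P)·(1 − ρ²)²)) · ( ‖z^1 − z^{1,⋆}‖_P² + 2·λ_max(P)·( n·C_{K,2} + D_{K,2} ) ),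 where C_{K,2} := Σ_{k=2}^K ‖x^{k,⋆} − x^{k−1,⋆}‖² and D_{K,2} := Σ_{k=2}^K ‖∇^{k,⋆} − ∇^{k−1,⋆}‖². -/

import Mathlib

open Matrix Finset

/-- The `P`-norm `‖v‖_P = √(vᵀ P v)`. -/
noncomputable def Pnorm {ι : Type*} [Fintype ι] (P : Matrix ι ι ℝ) (v : ι → ℝ) : ℝ :=
  Real.sqrt (v ⬝ᵥ P.mulVec v)

/-- The Euclidean norm of a finitely supported real vector. -/
noncomputable def vnorm {ι : Type*} [Fintype ι] (v : ι → ℝ) : ℝ :=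
  Real.sqrt (v ⬝ᵥ v)

/-- Smallest eigenvalue of a hermitian (real symmetric) matrix. -/
noncomputable def lamMin {ι : Type*} [Fintype ι] [DecidableEq ι]
    (P : Matrix ι ι ℝ) (hP : P.IsHermitian) : ℝ := ⨅ i, hP.eigenvalues i

/-- Largest eigenvalue of a hermitian (real symmetric) matrix. -/
noncomputable def lamMax {ι : Type*} [Fintype ι] [DecidableEq ι]
    (P : Matrix ι ι ℝ) (hP : P.IsHermitian) : ℝ := ⨆ i, hP.eigenvalues i

theorem dotProduct_mulVec_eq_sum_eigenvalues {ι : Type*} [Fintype ι] [DecidableEq ι]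
    {P : Matrix ι ι ℝ} (hP : P.IsHermitian) (v : ι → ℝ) :
    v ⬝ᵥ P.mulVec v =
      ∑ i, hP.eigenvalues i * (hP.eigenvectorBasis i ⬝ᵥ v) ^ 2 := by
  have h := hP.eigenvectorBasis.sum_inner_mul_inner (WithLp.toLp 2 v)
    (WithLp.toLp 2 (P.mulVec v))
  simp only [EuclideanSpace.inner_eq_star_dotProduct, star_trivial] at h
  rw [dotProduct_comm, ← h]
  refine Finset.sum_congr rfl fun i _ => ?_
  have hsymm : Pᵀ = P := by rw [← conjTranspose_eq_transpose_of_trivial, hP.eq]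
  have h2 : P.mulVec v ⬝ᵥ hP.eigenvectorBasis i =
      hP.eigenvalues i * (hP.eigenvectorBasis i ⬝ᵥ v) := by
    rw [dotProduct_comm, dotProduct_mulVec, ← mulVec_transpose, hsymm, hP.mulVec_eigenvectorBasis,
      smul_dotProduct, smul_eq_mul]
  rw [h2]
  ring

theorem dotProduct_self_eq_sum_eigenvectorBasis {ι : Type*} [Fintype ι] [DecidableEq ι]
    {P : Matrix ι ι ℝ} (hP : P.IsHermitian) (v : ι → ℝ) :
    v ⬝ᵥ v = ∑ i, (hP.eigenvectorBasis i ⬝ᵥ v) ^ 2 := by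
  have h := hP.eigenvectorBasis.sum_inner_mul_inner (WithLp.toLp 2 v) (WithLp.toLp 2 v)
  simp only [EuclideanSpace.inner_eq_star_dotProduct, star_trivial] at h
  rw [← h]
  refine Finset.sum_congr rfl fun i _ => ?_
  rw [dotProduct_comm v, sq]

theorem lamMin_mul_dotProduct_self_le {ι : Type*} [Fintype ι] [DecidableEq ι]
    {P : Matrix ι ι ℝ} (hP : P.IsHermitian) (v : ι → ℝ) :
    lamMin P hP * (v ⬝ᵥ v) ≤ v ⬝ᵥ P.mulVec v := by
  rw [dotProduct_mulVec_eq_sum_eigenvalues hP, dotProduct_self_eq_sum_eigenvectorBasis hP,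
    Finset.mul_sum]
  gcongr with i
  exact ciInf_le (Set.finite_range _).bddBelow i

theorem dotProduct_mulVec_le_lamMax_mul {ι : Type*} [Fintype ι] [DecidableEq ι]
    {P : Matrix ι ι ℝ} (hP : P.IsHermitian) (v : ι → ℝ) :
    v ⬝ᵥ P.mulVec v ≤ lamMax P hP * (v ⬝ᵥ v) := by
  rw [dotProduct_mulVec_eq_sum_eigenvalues hP, dotProduct_self_eq_sum_eigenvectorBasis hP,
    Finset.mul_sum]
  gcongr with i
  exact le_ciSup (Set.finite_range _).bddAbove i

theorem lamMin_pos {ι : Type*} [Fintype ι] [DecidableEq ι] [Nonempty ι]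
    {P : Matrix ι ι ℝ} (hP : P.PosDef) : 0 < lamMin P hP.1 := by
  obtain ⟨i, hi⟩ := exists_eq_ciInf_of_finite (f := hP.1.eigenvalues)
  rw [lamMin, ← hi]
  exact hP.eigenvalues_pos i

theorem dotProduct_mulVec_self_nonneg {ι : Type*} [Fintype ι]
    {P : Matrix ι ι ℝ} (hP : P.PosSemidef) (v : ι → ℝ) : 0 ≤ v ⬝ᵥ P.mulVec v := by
  simpa using hP.dotProduct_mulVec_nonneg v

theorem Pnorm_sq {ι : Type*} [Fintype ι] {P : Matrix ι ι ℝ} (hP : P.PosSemidef) (v : ι → ℝ) :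
    Pnorm P v ^ 2 = v ⬝ᵥ P.mulVec v :=
  Real.sq_sqrt (dotProduct_mulVec_self_nonneg hP v)

theorem vnorm_nonneg {ι : Type*} [Fintype ι] (v : ι → ℝ) : 0 ≤ vnorm v :=
  Real.sqrt_nonneg _

theorem vnorm_sq {ι : Type*} [Fintype ι] (v : ι → ℝ) : vnorm v ^ 2 = v ⬝ᵥ v :=
  Real.sq_sqrt (Finset.sum_nonneg fun i _ => mul_self_nonneg (v i))

/-- Young's inequality for the squared `P`-norm of a difference. -/
theorem Pnorm_sub_sq_le {ι : Type*} [Fintype ι] {P : Matrix ι ι ℝ} (hP : P.PosSemidef)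
    {t : ℝ} (ht : 0 < t) (u v : ι → ℝ) :
    Pnorm P (u - v) ^ 2 ≤ (1 + t) * Pnorm P u ^ 2 + (1 + t⁻¹) * Pnorm P v ^ 2 := by
  have h := dotProduct_mulVec_self_nonneg hP (t • u + v)
  simp only [Pnorm_sq hP, mulVec_sub, mulVec_add, mulVec_smul, dotProduct_sub, sub_dotProduct,
    dotProduct_add, add_dotProduct, smul_dotProduct, dotProduct_smul, smul_eq_mul] at h ⊢
  have h' := mul_nonneg (inv_pos.2 ht).le h
  have e' : t⁻¹ * (t * (t * (u ⬝ᵥ P.mulVec u) + v ⬝ᵥ P.mulVec u) +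
      (t * (u ⬝ᵥ P.mulVec v) + v ⬝ᵥ P.mulVec v)) = t * (u ⬝ᵥ P.mulVec u) + v ⬝ᵥ P.mulVec u +
      u ⬝ᵥ P.mulVec v + t⁻¹ * (v ⬝ᵥ P.mulVec v) := by
    field_simp
    ring
  linarith

/-- A function with `L`-Lipschitz gradient grows at most quadratically around a critical point. -/
theorem sub_le_mul_norm_sq_of_gradient_lipschitz {E : Type*} [NormedAddCommGroup E]
    [InnerProductSpace ℝ E] [CompleteSpace E] {f : E → ℝ} {L : ℝ} (hL : 0 ≤ L) {a : E}
    (hf : Differentiable ℝ f) (hlip : ∀ w v : E, ‖gradient f w - gradient f v‖ ≤ L * ‖w - v‖)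
    (ha : gradient f a = 0) (y : E) : f y - f a ≤ L * ‖y - a‖ ^ 2 := by
  have h := (convex_closedBall a ‖y - a‖).norm_image_sub_le_of_norm_fderiv_le
    (f := f) (𝕜 := ℝ) (C := L * ‖y - a‖) (x := a) (y := y) (fun w _ => hf w) ?_
    (Metric.mem_closedBall_self (norm_nonneg _)) (by simp [dist_eq_norm])
  · calc f y - f a ≤ ‖f y - f a‖ := Real.le_norm_self _
      _ ≤ L * ‖y - a‖ ^ 2 := by rw [sq, ← mul_assoc]; exact h
  · intro w hw
    have h1 := hlip w a
    rw [ha, sub_zero, gradient, LinearIsometryEquiv.norm_map] at h1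
    rw [Metric.mem_closedBall, dist_eq_norm] at hw
    exact h1.trans (by gcongr)

/-- Summing a linear recursion with contraction factor `q`. -/
theorem sum_Icc_le_of_contraction {A e : ℕ → ℝ} {q c : ℝ}
    (h : ∀ k, 1 ≤ k → A (k + 1) ≤ q * A k + c * e (k + 1)) {K : ℕ} (hK : 1 ≤ K) :
    (1 - q) * ∑ k ∈ Finset.Icc 1 K, A k + q * A K ≤ A 1 + c * ∑ k ∈ Finset.Icc 2 K, e k := by
  induction K, hK using Nat.le_induction with
  | base => simp; linarith
  | succ K hK ih =>
    rw [Finset.sum_Icc_succ_top (by omega), Finset.sum_Icc_succ_top (by omega)]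
    linarith [h K hK]

/-- Cumulative squared tracking error of a contractive iteration with a moving fixed point. -/
theorem sum_Pnorm_sq_le {ι : Type*} [Fintype ι] {P : Matrix ι ι ℝ} (hP : P.PosSemidef)
    {ρ : ℝ} (hρ0 : 0 < ρ) (hρ1 : ρ < 1) {z zs : ℕ → ι → ℝ}
    (hcontract : ∀ k, Pnorm P (z (k + 1) - zs k) ≤ ρ * Pnorm P (z k - zs k)) (K : ℕ) :
    ∑ k ∈ Finset.Icc 1 K, Pnorm P (z k - zs k) ^ 2 ≤
      2 / (1 - ρ ^ 2) ^ 2 * (Pnorm P (z 1 - zs 1) ^ 2 +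
        2 * ∑ k ∈ Finset.Icc 2 K, Pnorm P (zs k - zs (k - 1)) ^ 2) := by
  have hρ : 0 < 1 - ρ ^ 2 := by nlinarith
  have hE : 0 ≤ ∑ k ∈ Finset.Icc 2 K, Pnorm P (zs k - zs (k - 1)) ^ 2 :=
    Finset.sum_nonneg fun _ _ => sq_nonneg _
  rcases Nat.eq_zero_or_pos K with rfl | hK
  · simp only [zero_lt_one, Finset.Icc_eq_empty_of_lt, Finset.sum_empty]
    positivity
  have hstep : ∀ k, 1 ≤ k → Pnorm P (z (k + 1) - zs (k + 1)) ^ 2 ≤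
      (1 + ρ ^ 2) / 2 * Pnorm P (z k - zs k) ^ 2 +
        2 / (1 - ρ ^ 2) * Pnorm P (zs (k + 1) - zs (k + 1 - 1)) ^ 2 := by
    intro k _
    have ht : 0 < (1 - ρ ^ 2) / (2 * ρ ^ 2) := by positivity
    have hY := Pnorm_sub_sq_le hP ht (z (k + 1) - zs k) (zs (k + 1) - zs k)
    rw [sub_sub_sub_cancel_right] at hY
    have hc : Pnorm P (z (k + 1) - zs k) ^ 2 ≤ ρ ^ 2 * Pnorm P (z k - zs k) ^ 2 := by
      rw [← mul_pow]
      exact pow_le_pow_left₀ (Real.sqrt_nonneg _) (hcontract k) 2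
    refine hY.trans (add_le_add ?_ ?_)
    · calc (1 + (1 - ρ ^ 2) / (2 * ρ ^ 2)) * Pnorm P (z (k + 1) - zs k) ^ 2
          ≤ (1 + (1 - ρ ^ 2) / (2 * ρ ^ 2)) * (ρ ^ 2 * Pnorm P (z k - zs k) ^ 2) := by gcongr
        _ = (1 + ρ ^ 2) / 2 * Pnorm P (z k - zs k) ^ 2 := by field_simp; ring
    · rw [Nat.add_sub_cancel]
      gcongr
      rw [inv_div, ← sub_nonneg]
      have : 2 / (1 - ρ ^ 2) - (1 + 2 * ρ ^ 2 / (1 - ρ ^ 2)) = 1 := by field_simp; ring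
      linarith
  have hsum := sum_Icc_le_of_contraction (A := fun k => Pnorm P (z k - zs k) ^ 2)
    (e := fun k => Pnorm P (zs k - zs (k - 1)) ^ 2) hstep hK
  beta_reduce at hsum
  have hq : 0 ≤ (1 + ρ ^ 2) / 2 * Pnorm P (z K - zs K) ^ 2 := by positivity
  have hA : 0 ≤ Pnorm P (z 1 - zs 1) ^ 2 := sq_nonneg _
  generalize ∑ k ∈ Finset.Icc 1 K, Pnorm P (z k - zs k) ^ 2 = S at *
  generalize ∑ k ∈ Finset.Icc 2 K, Pnorm P (zs k - zs (k - 1)) ^ 2 = E at *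
  generalize Pnorm P (z 1 - zs 1) ^ 2 = A at *
  rw [div_mul_eq_mul_div, le_div_iff₀ (by positivity)]
  have h2 : (1 - ρ ^ 2) / 2 * S ≤ A + 2 / (1 - ρ ^ 2) * E := by linarith
  have h3 := mul_le_mul_of_nonneg_left h2 (by positivity : 0 ≤ 2 * (1 - ρ ^ 2))
  have e3 : 2 * (1 - ρ ^ 2) * (A + 2 / (1 - ρ ^ 2) * E) = 2 * (1 - ρ ^ 2) * A + 4 * E := by
    field_simp; ring
  have h4 : 0 ≤ ρ ^ 2 * A := by positivity
  linarith

theorem dotProduct_self_prod_eq_sum_norm_sq {n d : ℕ} (v : Fin n → EuclideanSpace ℝ (Fin d)) :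
    (fun q : Fin n × Fin d => v q.1 q.2) ⬝ᵥ (fun q => v q.1 q.2) = ∑ j, ‖v j‖ ^ 2 := by
  simp only [dotProduct, Fintype.sum_prod_type, EuclideanSpace.real_norm_sq_eq]
  simp only [sq]

/-- **Corollary 3 (concrete form).** For the block-structured fixed point
`z^{k,⋆} = (x̲^{k,⋆}, 0, ∇^{k,⋆})` with `x̲^{k,⋆}` the `n`-fold stacked optimizer,
the dynamic regret of GGT is bounded by
`(2Lρ²/(n·λ_min(P)(1-ρ²)²))·(‖z^1 - z^{1,⋆}‖_P² + 2λ_max(P)(n·C_{K,2} + D_{K,2}))`. -/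
theorem ggt_regret_cumulative_variations {d n m₀ : ℕ}
    (P : Matrix ((Fin n × Fin d) ⊕ Fin m₀ ⊕ (Fin n × Fin d))
      ((Fin n × Fin d) ⊕ Fin m₀ ⊕ (Fin n × Fin d)) ℝ) (hP : P.PosDef)
    (ρ L : ℝ) (hρ0 : 0 < ρ) (hρ1 : ρ < 1) (hL : 0 < L) (K : ℕ)
    (f : ℕ → EuclideanSpace ℝ (Fin d) → ℝ)
    (xs : ℕ → EuclideanSpace ℝ (Fin d))
    (x : ℕ → Fin n → EuclideanSpace ℝ (Fin d))
    (gs : ℕ → (Fin n × Fin d) → ℝ)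
    (hdiff : ∀ k, Differentiable ℝ (f k))
    (hsmooth : ∀ k, ∀ w v : EuclideanSpace ℝ (Fin d),
      ‖gradient (f k) w - gradient (f k) v‖ ≤ L * ‖w - v‖)
    (hgrad0 : ∀ k, gradient (f k) (xs k) = 0)
    (z zs : ℕ → ((Fin n × Fin d) ⊕ Fin m₀ ⊕ (Fin n × Fin d)) → ℝ)
    (hzs : ∀ k, zs k =
      Sum.elim (fun q : Fin n × Fin d => xs k q.2) (Sum.elim 0 (gs k)))
    (hcontract : ∀ k, Pnorm P (z (k + 1) - zs k) ≤ ρ * Pnorm P (z k - zs k))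
    (hsub : ∀ k, vnorm (fun q : Fin n × Fin d => x k q.1 q.2 - xs k q.2) ≤
      vnorm (z (k + 1) - zs k)) :
    (1 / (n : ℝ)) * ∑ j : Fin n, ∑ k ∈ Finset.Icc 1 K, (f k (x k j) - f k (xs k)) ≤
      2 * L * ρ ^ 2 / (n * lamMin P hP.1 * (1 - ρ ^ 2) ^ 2) *
        ((Pnorm P (z 1 - zs 1)) ^ 2
          + 2 * lamMax P hP.1 *
            (n * ∑ k ∈ Finset.Icc 2 K, ‖xs k - xs (k - 1)‖ ^ 2
              + ∑ k ∈ Finset.Icc 2 K, (vnorm (gs k - gs (k - 1))) ^ 2)) := by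
  have hdesc : ∀ k (j : Fin n), f k (x k j) - f k (xs k) ≤ L * ‖x k j - xs k‖ ^ 2 := fun k j =>
    sub_le_mul_norm_sq_of_gradient_lipschitz hL.le (hdiff k) (hsmooth k) (hgrad0 k) _
  rcases isEmpty_or_nonempty (Fin n × Fin d) with hemp | hne
  · have hterm : ∀ k (j : Fin n), f k (x k j) - f k (xs k) = 0 := by
      intro k j
      have : x k j = xs k := by
        ext i
        exact hemp.elim (j, i)
      rw [this, sub_self]
    simp only [hterm, Finset.sum_const_zero, mul_zero]
    have h1 : 0 ≤ lamMin P hP.1 := Real.iInf_nonneg fun i => (hP.eigenvalues_pos i).le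
    have h2 : 0 ≤ lamMax P hP.1 := Real.iSup_nonneg fun i => (hP.eigenvalues_pos i).le
    positivity
  have hn : 0 < (n : ℝ) := Nat.cast_pos.2 (Fin.pos hne.some.1)
  have hlam := lamMin_pos hP
  have hround : ∀ k, ∑ j, (f k (x k j) - f k (xs k)) ≤
      L * ρ ^ 2 / lamMin P hP.1 * Pnorm P (z k - zs k) ^ 2 := by
    intro k
    have h1 : ∑ j, ‖x k j - xs k‖ ^ 2 ≤ vnorm (z (k + 1) - zs k) ^ 2 := by
      have := pow_le_pow_left₀ (vnorm_nonneg _) (hsub k) 2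
      rw [vnorm_sq (fun q : Fin n × Fin d => x k q.1 q.2 - xs k q.2)] at this
      exact (dotProduct_self_prod_eq_sum_norm_sq fun j => x k j - xs k).ge.trans this
    have h2 : lamMin P hP.1 * vnorm (z (k + 1) - zs k) ^ 2 ≤ Pnorm P (z (k + 1) - zs k) ^ 2 := by
      rw [vnorm_sq, Pnorm_sq hP.posSemidef]
      exact lamMin_mul_dotProduct_self_le hP.1 _
    have h3 := pow_le_pow_left₀ (Real.sqrt_nonneg _) (hcontract k) 2
    rw [mul_pow] at h3
    calc ∑ j, (f k (x k j) - f k (xs k)) ≤ ∑ j, L * ‖x k j - xs k‖ ^ 2 :=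
          Finset.sum_le_sum fun j _ => hdesc k j
      _ = L * ∑ j, ‖x k j - xs k‖ ^ 2 := by rw [Finset.mul_sum]
      _ ≤ L * (ρ ^ 2 * Pnorm P (z k - zs k) ^ 2 / lamMin P hP.1) := by
          gcongr
          rw [le_div_iff₀ hlam, mul_comm]
          exact (mul_le_mul_of_nonneg_left h1 hlam.le).trans (h2.trans h3)
      _ = _ := by ring
  have hpath : ∀ k, Pnorm P (zs k - zs (k - 1)) ^ 2 ≤ lamMax P hP.1 *
      (n * ‖xs k - xs (k - 1)‖ ^ 2 + vnorm (gs k - gs (k - 1)) ^ 2) := by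
    intro k
    rw [Pnorm_sq hP.posSemidef]
    refine (dotProduct_mulVec_le_lamMax_mul hP.1 _).trans_eq ?_
    have hblock : (n : ℝ) * ‖xs k - xs (k - 1)‖ ^ 2 =
        ∑ q : Fin n × Fin d, (xs k q.2 - xs (k - 1) q.2) * (xs k q.2 - xs (k - 1) q.2) := by
      simpa [dotProduct] using
        (dotProduct_self_prod_eq_sum_norm_sq fun _ : Fin n => xs k - xs (k - 1)).symm
    rw [hzs, hzs, vnorm_sq, hblock]
    simp [dotProduct, Fintype.sum_sum_type]
  have hE : ∑ k ∈ Finset.Icc 2 K, Pnorm P (zs k - zs (k - 1)) ^ 2 ≤ lamMax P hP.1 *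
      (n * ∑ k ∈ Finset.Icc 2 K, ‖xs k - xs (k - 1)‖ ^ 2
        + ∑ k ∈ Finset.Icc 2 K, vnorm (gs k - gs (k - 1)) ^ 2) := by
    rw [Finset.mul_sum, ← Finset.sum_add_distrib, Finset.mul_sum]
    exact Finset.sum_le_sum fun k _ => hpath k
  have hρ : 0 < 1 - ρ ^ 2 := by nlinarith
  rw [Finset.sum_comm]
  calc (1 / (n : ℝ)) * ∑ k ∈ Finset.Icc 1 K, ∑ j, (f k (x k j) - f k (xs k))
      ≤ (1 / (n : ℝ)) * ∑ k ∈ Finset.Icc 1 K,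
          L * ρ ^ 2 / lamMin P hP.1 * Pnorm P (z k - zs k) ^ 2 := by
        gcongr with k
        exact hround k
    _ = L * ρ ^ 2 / (n * lamMin P hP.1) * ∑ k ∈ Finset.Icc 1 K, Pnorm P (z k - zs k) ^ 2 := by
        rw [← Finset.mul_sum]
        field_simp
    _ ≤ L * ρ ^ 2 / (n * lamMin P hP.1) * (2 / (1 - ρ ^ 2) ^ 2 * (Pnorm P (z 1 - zs 1) ^ 2 +
          2 * ∑ k ∈ Finset.Icc 2 K, Pnorm P (zs k - zs (k - 1)) ^ 2)) := by
        gcongr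
        exact sum_Pnorm_sq_le hP.posSemidef hρ0 hρ1 hcontract K
    _ = 2 * L * ρ ^ 2 / (n * lamMin P hP.1 * (1 - ρ ^ 2) ^ 2) * (Pnorm P (z 1 - zs 1) ^ 2 +
          2 * ∑ k ∈ Finset.Icc 2 K, Pnorm P (zs k - zs (k - 1)) ^ 2) := by
        field_simp
    _ ≤ _ := by
        rw [mul_assoc 2 (lamMax P hP.1)]
        gcongr
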